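/- For u, v ∈ ℚ² \ ℤ² with u ≢ ±v (mod ℤ²) and τ in the upper half-plane, the first Fricke functions satisfy (f_u(τ) − f_v(τ))⁶ = [j(τ)²(j(τ)−1728)³ / (2³⁰·3²⁴)] · g_{u+v}(τ)⁶ g_{u−v}(τ)⁶ / (g_u(τ)¹² g_v(τ)¹²). -/

import Mathlib

open Complex

/-- The point `m ω₁ + n ω₂` of the lattice `ℤω₁ + ℤω₂`. -/
noncomputable def latticePt (om1 om2 : ℂ) (p : ℤ × ℤ) : ℂ := p.1 * om1 + p.2 * om2

/-- `g₂(Λ)` for `Λ = ℤω₁ + ℤω₂`. -/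
noncomputable def g2 (om1 om2 : ℂ) : ℂ :=
  60 * ∑' p : {p : ℤ × ℤ // p ≠ 0}, 1 / latticePt om1 om2 p.1 ^ 4

/-- `g₃(Λ)` for `Λ = ℤω₁ + ℤω₂`. -/
noncomputable def g3 (om1 om2 : ℂ) : ℂ :=
  140 * ∑' p : {p : ℤ × ℤ // p ≠ 0}, 1 / latticePt om1 om2 p.1 ^ 6

/-- `Δ(Λ) = g₂³ − 27g₃²`. -/
noncomputable def disc (om1 om2 : ℂ) : ℂ := g2 om1 om2 ^ 3 - 27 * g3 om1 om2 ^ 2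

/-- The Weierstrass ℘-function relative to `ℤω₁ + ℤω₂`. -/
noncomputable def wp (om1 om2 z : ℂ) : ℂ :=
  1 / z ^ 2 + ∑' p : {p : ℤ × ℤ // p ≠ 0},
    (1 / (z - latticePt om1 om2 p.1) ^ 2 - 1 / latticePt om1 om2 p.1 ^ 2)

/-- The elliptic modular function `j(τ) = 1728 g₂([τ,1])³ / Δ([τ,1])`. -/
noncomputable def jInv (tau : ℂ) : ℂ := 1728 * g2 tau 1 ^ 3 / disc tau 1

/-- The first Fricke function
`f_{[r₁,r₂]}(τ) = (g₂([τ,1])g₃([τ,1])/Δ([τ,1])) ℘(r₁τ + r₂; [τ,1])`. -/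
noncomputable def fricke (r1 r2 : ℚ) (tau : ℂ) : ℂ :=
  g2 tau 1 * g3 tau 1 / disc tau 1 * wp tau 1 ((r1 : ℂ) * tau + (r2 : ℂ))

/-- `(r₁,r₂)` lies in `ℤ²`. -/
def isIntPair (r : ℚ × ℚ) : Prop := ∃ m n : ℤ, r.1 = m ∧ r.2 = n

/-- `q^s = e^{2πiτs}`. -/
noncomputable def qpow (tau s : ℂ) : ℂ := Complex.exp (2 * Real.pi * Complex.I * tau * s)

/-- The second Bernoulli polynomial `B₂(X) = X² − X + 1/6`. -/
noncomputable def B2 (x : ℂ) : ℂ := x ^ 2 - x + 1 / 6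

/-- The Siegel function `g_{[r₁,r₂]}(τ)`. -/
noncomputable def siegel (r1 r2 : ℝ) (tau : ℂ) : ℂ :=
  -Complex.exp (Real.pi * Complex.I * r2 * (r1 - 1)) * qpow tau (B2 r1 / 2) *
    (1 - qpow tau r1 * Complex.exp (2 * Real.pi * Complex.I * r2)) *
    ∏' n : ℕ, ((1 - qpow tau ((n + 1 : ℕ) + r1) * Complex.exp (2 * Real.pi * Complex.I * r2)) *
      (1 - qpow tau ((n + 1 : ℕ) - r1) * Complex.exp (-(2 * Real.pi * Complex.I * r2))))

noncomputable def qE (q x : ℂ) : ℂ := ∏' n : ℕ, (1 - q ^ n * x)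

lemma qE_summable {q : ℂ} (hq : ‖q‖ < 1) (x : ℂ) : Summable fun n : ℕ => ‖-(q ^ n * x)‖ := by
  simpa using (summable_geometric_of_lt_one (norm_nonneg _) hq).mul_right ‖x‖

lemma qE_multipliable {q : ℂ} (hq : ‖q‖ < 1) (x : ℂ) :
    Multipliable fun n : ℕ => 1 - q ^ n * x := by
  simpa [sub_eq_add_neg] using multipliable_one_add_of_summable (qE_summable hq x)

lemma qE_ne_zero {q : ℂ} (hq : ‖q‖ < 1) (x : ℂ) (h : ∀ n : ℕ, q ^ n * x ≠ 1) : qE q x ≠ 0 := by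
  have := tprod_one_add_ne_zero_of_summable (f := fun n : ℕ => -(q ^ n * x))
    (fun i => by
      have := h i
      rw [← sub_eq_add_neg]
      exact sub_ne_zero.mpr this.symm) (qE_summable hq x)
  simpa [qE, sub_eq_add_neg] using this

lemma qE_succ {q : ℂ} (hq : ‖q‖ < 1) (x : ℂ) : qE q x = (1 - x) * qE q (q * x) := by
  have h1 := qE_multipliable hq (q * x)
  have e (n : ℕ) : 1 - q ^ n * (q * x) = 1 - q ^ (n + 1) * x := by ring
  simp only [e] at h1
  have h2 := tprod_eq_zero_mul' (f := fun n : ℕ => 1 - q ^ n * x) h1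
  simp only [pow_zero, one_mul] at h2
  unfold qE
  simp only [e]
  exact h2

lemma qE_differentiable {q : ℂ} (hq : ‖q‖ < 1) : Differentiable ℂ (qE q) := by
  intro x
  have H : HasProdLocallyUniformlyOn (fun (n : ℕ) (x : ℂ) => 1 + -(q ^ n * x))
      (fun x => ∏' n : ℕ, (1 + -(q ^ n * x))) (Metric.ball 0 (‖x‖ + 1)) := by
    refine Summable.hasProdLocallyUniformlyOn_nat_one_add (u := fun n => ‖q‖ ^ n * (‖x‖ + 1))
      Metric.isOpen_ball
      ((summable_geometric_of_lt_one (norm_nonneg _) hq).mul_right _) ?_ ?_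
    · refine .of_forall fun n y hy => ?_
      simp only [norm_neg, norm_mul, norm_pow]
      gcongr
      simpa using (le_of_lt (by simpa using hy) : ‖y‖ ≤ ‖x‖ + 1)
    · intro n; fun_prop
  have h2 := H.differentiableOn (.of_forall fun s => by
    simpa [Finset.prod_fn] using DifferentiableOn.finsetProd (fun _ _ ↦ by fun_prop))
    Metric.isOpen_ball
  have h3 : qE q = fun x => ∏' n : ℕ, (1 + -(q ^ n * x)) := by
    ext y; simp [qE, sub_eq_add_neg]
  rw [h3]
  exact (h2 x (by simp)).differentiableAt (Metric.isOpen_ball.mem_nhds (by simp))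

noncomputable def gth (t z : ℂ) : ℂ :=
  cexp (-(Real.pi * I * z)) * qE (cexp (2 * Real.pi * I * t)) (cexp (2 * Real.pi * I * z)) *
    qE (cexp (2 * Real.pi * I * t)) (cexp (2 * Real.pi * I * t) * cexp (-(2 * Real.pi * I * z)))

lemma norm_q_lt {t : ℂ} (ht : 0 < t.im) : ‖cexp (2 * Real.pi * I * t)‖ < 1 := by
  simpa using UpperHalfPlane.norm_exp_two_pi_I_lt_one ⟨t, ht⟩

lemma gth_differentiable {t : ℂ} (ht : 0 < t.im) : Differentiable ℂ (gth t) := by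
  have h := qE_differentiable (norm_q_lt ht)
  unfold gth
  fun_prop

lemma gth_neg {t : ℂ} (ht : 0 < t.im) (z : ℂ) : gth t (-z) = - gth t z := by
  unfold gth
  have h1 := qE_succ (norm_q_lt ht) (cexp (2 * Real.pi * I * z))
  have h2 := qE_succ (norm_q_lt ht) (cexp (-(2 * Real.pi * I * z)))
  simp only [mul_neg, neg_neg]
  rw [h1, h2]
  have e1 : cexp (2 * Real.pi * I * z) = cexp (Real.pi * I * z) ^ 2 := by
    rw [← Complex.exp_nat_mul]; ring_nf
  have e2 : cexp (-(2 * Real.pi * I * z)) = (cexp (Real.pi * I * z))⁻¹ ^ 2 := by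
    rw [← Complex.exp_neg, ← Complex.exp_nat_mul]; ring_nf
  have e3 : cexp (-(Real.pi * I * z)) = (cexp (Real.pi * I * z))⁻¹ := Complex.exp_neg _
  have h0 := Complex.exp_ne_zero (Real.pi * I * z)
  rw [e1, e2, e3]
  generalize qE _ _ = A
  generalize qE _ _ = B
  field_simp
  ring

lemma gth_add_one (t z : ℂ) : gth t (z + 1) = - gth t z := by
  unfold gth
  have e1 : cexp (2 * Real.pi * I * (z + 1)) = cexp (2 * Real.pi * I * z) := by
    rw [mul_add, mul_one, Complex.exp_add, Complex.exp_two_pi_mul_I, mul_one]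
  have e2 : cexp (-(Real.pi * I * (z + 1))) = - cexp (-(Real.pi * I * z)) := by
    rw [mul_add, mul_one, neg_add, Complex.exp_add, Complex.exp_neg (Real.pi * I),
      Complex.exp_pi_mul_I]; norm_num
  rw [e2, Complex.exp_neg (2 * Real.pi * I * (z + 1)), e1, ← Complex.exp_neg]
  ring

lemma gth_add_tau {t : ℂ} (ht : 0 < t.im) (z : ℂ) :
    gth t (z + t) = - cexp (-(Real.pi * I * t)) * cexp (-(2 * Real.pi * I * z)) * gth t z := by
  unfold gth
  have h1 := qE_succ (norm_q_lt ht) (cexp (2 * Real.pi * I * z))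
  have h2 := qE_succ (norm_q_lt ht) (cexp (-(2 * Real.pi * I * z)))
  have e1 : cexp (2 * Real.pi * I * (z + t)) =
      cexp (2 * Real.pi * I * t) * cexp (2 * Real.pi * I * z) := by
    rw [← Complex.exp_add]; ring_nf
  have e2 : cexp (2 * Real.pi * I * t) * cexp (-(2 * Real.pi * I * (z + t))) =
      cexp (-(2 * Real.pi * I * z)) := by
    rw [← Complex.exp_add]; ring_nf
  have e3 : cexp (-(Real.pi * I * (z + t))) = cexp (-(Real.pi * I * z)) * cexp (-(Real.pi * I * t)) := by
    rw [← Complex.exp_add]; ring_nf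
  have e4 : cexp (-(2 * Real.pi * I * z)) * cexp (2 * Real.pi * I * z) = 1 := by
    rw [← Complex.exp_add]; simp
  rw [e1, e2, e3, h1, h2]
  generalize qE _ _ = A
  generalize qE _ _ = B
  linear_combination (- cexp (-(Real.pi * I * z)) * cexp (-(Real.pi * I * t)) * A * B) * e4

lemma gth_ne_zero {t : ℂ} (ht : 0 < t.im) (z : ℂ) (h : ∀ m n : ℤ, z ≠ m * t + n) :
    gth t z ≠ 0 := by
  have hpi : (2 * Real.pi * I : ℂ) ≠ 0 := by simp [Real.pi_ne_zero]
  unfold gth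
  refine mul_ne_zero (mul_ne_zero (Complex.exp_ne_zero _) (qE_ne_zero (norm_q_lt ht) _ ?_))
    (qE_ne_zero (norm_q_lt ht) _ ?_)
  · intro n hn
    rw [← Complex.exp_nat_mul, ← Complex.exp_add, Complex.exp_eq_one_iff] at hn
    obtain ⟨k, hk⟩ := hn
    apply h (-n) k
    apply mul_left_cancel₀ hpi
    push_cast
    linear_combination hk
  · intro n hn
    rw [← Complex.exp_nat_mul, ← Complex.exp_add, ← Complex.exp_add, Complex.exp_eq_one_iff] at hn
    obtain ⟨k, hk⟩ := hn
    apply h (n + 1) (-k)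
    apply mul_left_cancel₀ hpi
    push_cast
    linear_combination -hk

lemma gth_zero {t : ℂ} (ht : 0 < t.im) : gth t 0 = 0 := by
  have := gth_neg ht 0
  rw [neg_zero] at this
  exact self_eq_neg.mp this

lemma gth_deriv_zero {t : ℂ} (ht : 0 < t.im) :
    HasDerivAt (gth t) (-(2 * Real.pi * I) * qE (cexp (2 * Real.pi * I * t)) (cexp (2 * Real.pi * I * t)) ^ 2) 0 := by
  set q := cexp (2 * Real.pi * I * t) with hq
  have hd := qE_differentiable (norm_q_lt ht)
  set k : ℂ → ℂ := fun z => cexp (-(Real.pi * I * z)) * qE q (q * cexp (2 * Real.pi * I * z)) *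
    qE q (q * cexp (-(2 * Real.pi * I * z))) with hk
  have hkd : Differentiable ℂ k := by
    rw [hk]; fun_prop
  have hg : gth t = fun z => (1 - cexp (2 * Real.pi * I * z)) * k z := by
    ext z
    unfold gth
    rw [qE_succ (norm_q_lt ht) (cexp (2 * Real.pi * I * z))]
    simp only [hk]; ring
  have h1 : HasDerivAt (fun z : ℂ => 1 - cexp (2 * Real.pi * I * z))
      (-(cexp (2 * Real.pi * I * 0) * (2 * Real.pi * I * 1))) 0 :=
    (((hasDerivAt_id (0:ℂ)).const_mul (2 * Real.pi * I)).cexp).const_sub 1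
  have h2 := h1.mul (hkd 0).hasDerivAt
  rw [hg]
  have h3 : -(cexp (2 * Real.pi * I * 0) * (2 * Real.pi * I * 1)) * k 0 +
      (1 - cexp (2 * Real.pi * I * 0)) * deriv k 0 = -(2 * Real.pi * I) * qE q q ^ 2 := by
    simp [hk]; ring
  rw [h3] at h2
  exact h2

lemma siegel_eq {t : ℂ} (ht : 0 < t.im) (a b : ℝ) :
    siegel a b t = - cexp (Real.pi * I * a * (a * t + b)) * cexp (2 * Real.pi * I * t / 12) *
      gth t (a * t + b) := by
  unfold siegel gth qpow B2
  set q := cexp (2 * Real.pi * I * t) with hq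
  have hqn : ‖q‖ < 1 := norm_q_lt ht
  have e1 : cexp (2 * Real.pi * I * t * a) * cexp (2 * Real.pi * I * b) =
      cexp (2 * Real.pi * I * (a * t + b)) := by
    rw [← Complex.exp_add]; ring_nf
  have e2 : ∀ n : ℕ, cexp (2 * Real.pi * I * t * ((n + 1 : ℕ) + a)) * cexp (2 * Real.pi * I * b) =
      q ^ n * (q * cexp (2 * Real.pi * I * (a * t + b))) := by
    intro n
    rw [hq, ← Complex.exp_nat_mul, ← Complex.exp_add, ← Complex.exp_add, ← Complex.exp_add]
    push_cast; ring_nf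
  have e3 : ∀ n : ℕ, cexp (2 * Real.pi * I * t * ((n + 1 : ℕ) - a)) * cexp (-(2 * Real.pi * I * b)) =
      q ^ n * (q * cexp (-(2 * Real.pi * I * (a * t + b)))) := by
    intro n
    rw [hq, ← Complex.exp_nat_mul, ← Complex.exp_add, ← Complex.exp_add, ← Complex.exp_add]
    push_cast; ring_nf
  simp only [e1, e2, e3]
  rw [(qE_multipliable hqn _).tprod_mul (qE_multipliable hqn _)]
  rw [qE_succ hqn (cexp (2 * Real.pi * I * (a * t + b)))]
  have e4 : cexp (Real.pi * I * b * (a - 1)) * cexp (2 * Real.pi * I * t * ((a ^ 2 - a + 1 / 6) / 2)) =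
      cexp (Real.pi * I * a * (a * t + b)) * cexp (2 * Real.pi * I * t / 12) *
        cexp (-(Real.pi * I * (a * t + b))) := by
    rw [← Complex.exp_add, ← Complex.exp_add, ← Complex.exp_add]; ring_nf
  change -_ * _ * _ * (qE _ _ * qE _ _) = _
  generalize qE _ _ = A
  generalize qE _ _ = B
  linear_combination (-(1 - cexp (2 * Real.pi * I * (a * t + b))) * A * B) * e4

lemma wp_eisen {t : ℂ} (ht : 0 < t.im) {k : ℕ} (hk : 3 ≤ k) :
    ∑' p : {p : ℤ × ℤ // p ≠ 0}, 1 / latticePt t 1 p.1 ^ k =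
      2 * riemannZeta k * ModularForm.E hk ⟨t, ht⟩ := by
  have h1 : ∑' p : {p : ℤ × ℤ // p ≠ 0}, 1 / latticePt t 1 p.1 ^ k =
      ∑' p : ℤ × ℤ, 1 / latticePt t 1 p ^ k := by
    refine tsum_subtype_eq_of_support_subset (f := fun p : ℤ × ℤ => 1 / latticePt t 1 p ^ k)
      (s := {p | p ≠ 0}) ?_
    intro p hp h0
    simp only [Function.mem_support] at hp
    apply hp
    rw [h0]
    simp [latticePt, show k ≠ 0 by omega]
  have h2 : ∑' p : ℤ × ℤ, 1 / latticePt t 1 p ^ k =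
      ∑' v : Fin 2 → ℤ, EisensteinSeries.eisSummand k v ⟨t, ht⟩ := by
    rw [← (finTwoArrowEquiv ℤ).tsum_eq]
    refine tsum_congr fun v => ?_
    simp [latticePt, EisensteinSeries.eisSummand]
  rw [h1, h2, tsum_eisSummand_eq_riemannZeta_mul_eisensteinSeries hk]
  have : ModularForm.E hk ⟨t, ht⟩ = 1 / 2 * eisensteinSeries (N := 1) 0 k ⟨t, ht⟩ := rfl
  rw [this]; ring

lemma bernoulli_six_val : bernoulli 6 = 1 / 42 := by
    rw [bernoulli_eq_bernoulli'_of_ne_one (by norm_num), bernoulli'_def]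
    have h5 : bernoulli' 5 = 0 := bernoulli'_eq_zero_of_odd (by decide) (by norm_num)
    norm_num [Finset.sum_range_succ, h5, bernoulli'_four, bernoulli'_three, bernoulli'_two, Nat.choose]
lemma zeta_six : riemannZeta 6 = (Real.pi : ℂ) ^ 6 / 945 := by
  have := riemannZeta_two_mul_nat (k := 3) (by norm_num)
  norm_num at this
  rw [this]
  rw [bernoulli_six_val]
  simp; ring

lemma discriminant_qE (t : ℂ) (ht : 0 < t.im) : ModularForm.discriminant ⟨t, ht⟩ = cexp (2 * Real.pi * I * t) *
      qE (cexp (2 * Real.pi * I * t)) (cexp (2 * Real.pi * I * t)) ^ 24 := by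
    rw [ModularForm.discriminant_eq_q_prod, 
      (ModularForm.multipliableLocallyUniformlyOn_eta.multipliable ht).tprod_pow]
    have h1 : ∏' n : ℕ, (1 - ModularForm.eta_q n t) = 
      qE (cexp (2 * Real.pi * I * t)) (cexp (2 * Real.pi * I * t)) := by
      unfold qE
      refine tprod_congr fun n => ?_
      rw [ModularForm.eta_q_eq_pow, pow_succ]
    rw [h1]
    have h2 : Function.Periodic.qParam 1 t = cexp (2 * Real.pi * I * t) := by
      simp [Function.Periodic.qParam]
    rw [h2]

lemma disc_eq {t : ℂ} (ht : 0 < t.im) :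
    disc t 1 = (2 * Real.pi) ^ 12 * cexp (2 * Real.pi * I * t) *
      qE (cexp (2 * Real.pi * I * t)) (cexp (2 * Real.pi * I * t)) ^ 24 := by
  have h := ModularForm.discriminant_eq_E₄_cube_sub_E₆_sq ⟨t, ht⟩
  have h4 := wp_eisen ht (k := 4) (by norm_num)
  have h6 := wp_eisen ht (k := 6) (by norm_num)
  have z4 := riemannZeta_four
  have z6 := zeta_six
  have hd := discriminant_qE t ht
  unfold disc g2 g3
  rw [h4, h6]
  push_cast
  rw [z4, z6, mul_assoc ((2 * (Real.pi : ℂ)) ^ 12), ← hd, h]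
  ring

noncomputable def pp (t : ℂ) (ht : 0 < t.im) : PeriodPair where
  ω₁ := t
  ω₂ := 1
  indep := by
    rw [LinearIndependent.pair_iff]
    intro x y h
    have h1 := congrArg Complex.im h
    have h2 := congrArg Complex.re h
    simp at h1 h2
    have hx : x = 0 := by
      rcases h1 with h1 | h1
      · exact h1
      · exact absurd h1 ht.ne'
    subst hx
    simpa using h2

lemma wp_eq {t : ℂ} (ht : 0 < t.im) (z : ℂ) : wp t 1 z = (pp t ht).weierstrassP z := by
  have h1 := (pp t ht).weierstrassPExcept_add 0 z
  rw [← h1]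
  have h2 : ∀ p : ℤ × ℤ, (((pp t ht).latticeEquivProd.symm p : (pp t ht).lattice) : ℂ) =
      latticePt t 1 p := fun p => (pp t ht).latticeEquiv_symm_apply p
  have h3 : (pp t ht).weierstrassPExcept 0 z = ∑' p : ℤ × ℤ,
      if latticePt t 1 p = 0 then 0 else
        (1 / (z - latticePt t 1 p) ^ 2 - 1 / latticePt t 1 p ^ 2) := by
    unfold PeriodPair.weierstrassPExcept
    rw [← (pp t ht).latticeEquivProd.symm.toEquiv.tsum_eq]
    refine tsum_congr fun p => ?_
    have := h2 p
    simp only [LinearEquiv.coe_toEquiv, this]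
  have h0 : ∀ p : ℤ × ℤ, latticePt t 1 p = 0 ↔ p = 0 := by
    intro p
    rw [← h2 p]
    simp
  have h4 : ∑' p : {p : ℤ × ℤ // p ≠ 0},
      (1 / (z - latticePt t 1 p.1) ^ 2 - 1 / latticePt t 1 p.1 ^ 2) = ∑' p : ℤ × ℤ,
      if latticePt t 1 p = 0 then 0 else
        (1 / (z - latticePt t 1 p) ^ 2 - 1 / latticePt t 1 p ^ 2) := by
    rw [← tsum_subtype_eq_of_support_subset (s := {p : ℤ × ℤ | p ≠ 0})]
    · refine tsum_congr fun p => ?_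
      rw [if_neg]
      rw [h0]
      exact p.2
    · intro p hp h
      apply hp
      simp only
      rw [if_pos ((h0 p).mpr h)]
  unfold wp
  rw [h4, ← h3]
  simp
  ring

lemma mem_pp {t : ℂ} (ht : 0 < t.im) (z : ℂ) :
    z ∈ (pp t ht).lattice ↔ ∃ m n : ℤ, m * t + n = z := by
  rw [PeriodPair.mem_lattice]
  simp [pp]

lemma gth_ne_zero' {t : ℂ} (ht : 0 < t.im) {z : ℂ} (h : z ∉ (pp t ht).lattice) : gth t z ≠ 0 :=
  gth_ne_zero ht z fun m n hmn => h ((mem_pp ht z).mpr ⟨m, n, hmn.symm⟩)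

noncomputable def gR (t a z : ℂ) : ℂ := gth t (z + a) * gth t (z - a) / gth t z ^ 2

lemma gR_periodic {t : ℂ} (ht : 0 < t.im) (a z l : ℂ) (hl : l ∈ (pp t ht).lattice) :
    gR t a (z + l) = gR t a z := by
  have h1 : Function.Periodic (gR t a) 1 := by
    intro z
    unfold gR
    rw [show z + 1 + a = (z + a) + 1 by ring, show z + 1 - a = (z - a) + 1 by ring,
      gth_add_one, gth_add_one, gth_add_one]
    simp
  have h2 : Function.Periodic (gR t a) t := by
    intro z
    unfold gR
    rw [show z + t + a = (z + a) + t by ring, show z + t - a = (z - a) + t by ring,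
      gth_add_tau ht, gth_add_tau ht, gth_add_tau ht]
    have e : cexp (-(2 * Real.pi * I * (z + a))) * cexp (-(2 * Real.pi * I * (z - a))) =
        cexp (-(2 * Real.pi * I * z)) ^ 2 := by
      rw [← Complex.exp_nat_mul, ← Complex.exp_add]; push_cast; ring_nf
    have hA := Complex.exp_ne_zero (-(Real.pi * I * t))
    have hB := Complex.exp_ne_zero (-(2 * Real.pi * I * z))
    rw [← mul_div_mul_left (gth t (z + a) * gth t (z - a)) (gth t z ^ 2)
      (pow_ne_zero 2 (mul_ne_zero hA hB))]
    congr 1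
    · linear_combination cexp (-(Real.pi * I * t)) ^ 2 * gth t (z + a) * gth t (z - a) * e
    · ring
  obtain ⟨m, n, rfl⟩ := (mem_pp ht l).mp hl
  have h3 := (h2.int_mul m).add_period (h1.int_mul n)
  have := h3 z
  simpa using this

lemma wp_sub_gR {t : ℂ} (ht : 0 < t.im) {a z : ℂ} (ha : a ∉ (pp t ht).lattice)
    (hz : z ∉ (pp t ht).lattice) :
    (pp t ht).weierstrassP z - (pp t ht).weierstrassP a =
      - (deriv (gth t) 0 ^ 2 / gth t a ^ 2) * gR t a z := by
  classical
  set L := pp t ht with hL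
  set c := deriv (gth t) 0 with hc
  set K := c ^ 2 / gth t a ^ 2 with hK
  have hga : gth t a ≠ 0 := gth_ne_zero' ht ha
  have hc0 : c ≠ 0 := by
    rw [hc, (gth_deriv_zero ht).deriv]
    refine mul_ne_zero (by simp [Real.pi_ne_zero]) (pow_ne_zero _ (qE_ne_zero (norm_q_lt ht) _ ?_))
    intro n hn
    have h1 := congrArg norm hn
    rw [← pow_succ, norm_pow, norm_one] at h1
    exact (pow_lt_one₀ (norm_nonneg _) (norm_q_lt ht) (Nat.succ_ne_zero n)).ne h1
  have hgd := gth_differentiable ht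
  have hg0 := gth_zero ht
  set s := dslope (gth t) 0 with hs
  have hsd : Differentiable ℂ s := by
    rw [← differentiableOn_univ, hs, Complex.differentiableOn_dslope Filter.univ_mem]
    exact hgd.differentiableOn
  have hs0 : s 0 = c := dslope_same _ _
  have hsz : ∀ z, gth t z = z * s z := by
    intro z
    have := sub_smul_dslope (gth t) 0 z
    rw [hg0] at this
    simpa using this.symm
  have hseven : ∀ z, s (-z) = s z := by
    intro z
    by_cases h : z = 0
    · simp [h]
    · have h1 := hsz (-z)
      rw [gth_neg ht, hsz z] at h1
      have : z * s (-z) = z * s z := by linear_combination h1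
      exact mul_left_cancel₀ h this
  set U : Set ℂ := ((L.lattice : Set ℂ) \ {0})ᶜ with hU
  have hUo : IsOpen U := L.isOpen_compl_lattice_sdiff
  have h0U : (0 : ℂ) ∈ U := by simp [hU]
  have hsU : ∀ z ∈ U, s z ≠ 0 := by
    intro z hzU
    by_cases h : z = 0
    · rw [h, hs0]; exact hc0
    · have hzL : z ∉ L.lattice := fun h' => hzU ⟨h', h⟩
      have := gth_ne_zero' ht hzL
      rw [hsz] at this
      exact right_ne_zero_of_mul this
  set h : ℂ → ℂ := fun z => gth t (z + a) * gth t (z - a) / s z ^ 2 with hh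
  have hhd : DifferentiableOn ℂ h U := by
    rw [hh]
    refine DifferentiableOn.div (Differentiable.differentiableOn (by fun_prop))
      (Differentiable.differentiableOn (by fun_prop)) fun z hz => pow_ne_zero 2 (hsU z hz)
  have hheven : ∀ z, h (-z) = h z := by
    intro z
    simp only [hh]
    rw [hseven, show -z + a = -(z - a) by ring, show -z - a = -(z + a) by ring,
      gth_neg ht, gth_neg ht]
    ring
  have hh0 : h 0 = - (gth t a ^ 2 / c ^ 2) := by
    simp only [hh, hs0, zero_add, zero_sub, gth_neg ht]
    ring
  have hh' : deriv h 0 = 0 := by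
    have h1 := deriv_comp_neg h 0
    simp only [hheven, neg_zero] at h1
    exact self_eq_neg.mp h1
  set h2 := dslope (dslope h 0) 0 with hh2
  have hU0 : U ∈ nhds (0 : ℂ) := hUo.mem_nhds h0U
  have hh2d : DifferentiableOn ℂ h2 U := by
    rw [hh2, Complex.differentiableOn_dslope hU0, Complex.differentiableOn_dslope hU0]
    exact hhd
  have hh2z : ∀ z, z ≠ 0 → h2 z = (h z - h 0) / z ^ 2 := by
    intro z hz
    rw [hh2, dslope_of_ne _ hz, slope_def_field, dslope_of_ne _ hz, slope_def_field, dslope_same,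
      hh']
    field_simp
    simp
    ring
  set M0 : ℂ → ℂ := fun z => L.weierstrassPExcept 0 z - L.weierstrassP a + K * h2 z with hM0
  have hM0d : DifferentiableOn ℂ M0 U :=
    ((L.differentiableOn_weierstrassPExcept 0).sub_const _).add (hh2d.const_mul K)
  set M : ℂ → ℂ := fun z => if z ∈ L.lattice then M0 0 else
    L.weierstrassP z - L.weierstrassP a + K * gR t a z with hM
  have hMU : ∀ z ∈ U, M z = M0 z := by
    intro z hzU
    by_cases hz0 : z = 0
    · rw [hz0]; simp [hM]
    · have hzL : z ∉ L.lattice := fun h' => hzU ⟨h', hz0⟩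
      simp only [hM, hM0, if_neg hzL]
      have e1 := L.weierstrassPExcept_add 0 z
      rw [hh2z z hz0, hh0, ← e1]
      have hsz0 := hsU z hzU
      simp only [gR, hh, hsz z, hK]
      simp
      field_simp
      ring
  have hMper : ∀ z l, l ∈ L.lattice → M (z + l) = M z := by
    intro z l hl
    have : z + l ∈ L.lattice ↔ z ∈ L.lattice := by
      simpa using (L.lattice.toAddSubgroup.add_mem_cancel_right (y := z) hl)
    simp only [hM, this, gR_periodic ht a z l hl, L.weierstrassP_add_coe z ⟨l, hl⟩]
  have hMdU : DifferentiableOn ℂ M U := hM0d.congr hMU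
  have hMd : Differentiable ℂ M := by
    intro x
    by_cases hx : x ∈ L.lattice
    · have e : M = fun z => M (z + -x) := by
        ext z
        rw [hMper z (-x) (neg_mem hx)]
      rw [e]
      have := (hMdU 0 h0U).differentiableAt hU0
      refine DifferentiableAt.comp x (f := fun z => z + -x) (g := M) ?_ (by fun_prop)
      simpa using this
    · have hxU : x ∈ U := fun h' => hx h'.1
      exact (hMdU x hxU).differentiableAt (hUo.mem_nhds hxU)
  have hconst := hMd.apply_eq_apply_of_bounded (IsZLattice.isCompact_range_of_periodic L.lattice _
    hMd.continuous fun z w hw ↦ hMper z w hw).isBounded z a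
  simp only [hM, if_neg hz, if_neg ha] at hconst
  have hRa : gR t a a = 0 := by simp [gR, hg0]
  rw [hRa] at hconst
  linear_combination hconst

lemma not_mem_of_not_int {t : ℂ} (ht : 0 < t.im) (r : ℚ × ℚ) (hr : ¬ isIntPair r) :
    (r.1 : ℂ) * t + (r.2 : ℂ) ∉ (pp t ht).lattice := by
  intro h
  have := (PeriodPair.mul_ω₁_add_mul_ω₂_mem_lattice (L := pp t ht) (α := r.1) (β := r.2)).mp
    (by simpa [pp] using h)
  exact hr ⟨r.1.num, r.2.num, ((Rat.den_eq_one_iff _).mp this.1).symm,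
    ((Rat.den_eq_one_iff _).mp this.2).symm⟩

/-- For `u, v ∈ ℚ² \\ ℤ²` with `u ≢ ±v (mod ℤ²)` and `τ` in the upper half-plane,
`(f_u(τ) − f_v(τ))⁶ = (j(τ)²(j(τ)−1728)³/(2³⁰3²⁴)) g_{u+v}(τ)⁶ g_{u−v}(τ)⁶ / (g_u(τ)¹² g_v(τ)¹²)`. -/
theorem fricke_diff_pow_six (u v : ℚ × ℚ) (hu : ¬isIntPair u) (hv : ¬isIntPair v)
    (huv1 : ¬isIntPair (u - v)) (huv2 : ¬isIntPair (u + v))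
    (tau : ℂ) (htau : 0 < tau.im) :
    (fricke u.1 u.2 tau - fricke v.1 v.2 tau) ^ 6 =
      jInv tau ^ 2 * (jInv tau - 1728) ^ 3 / (2 ^ 30 * 3 ^ 24) *
        (siegel (u.1 + v.1 : ℚ) (u.2 + v.2 : ℚ) tau ^ 6 *
          siegel (u.1 - v.1 : ℚ) (u.2 - v.2 : ℚ) tau ^ 6) /
        (siegel (u.1 : ℚ) (u.2 : ℚ) tau ^ 12 * siegel (v.1 : ℚ) (v.2 : ℚ) tau ^ 12) := by
  set zu : ℂ := (u.1 : ℂ) * tau + (u.2 : ℂ) with hzu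
  set zv : ℂ := (v.1 : ℂ) * tau + (v.2 : ℂ) with hzv
  have hu' := not_mem_of_not_int htau u hu
  have hv' := not_mem_of_not_int htau v hv
  have key := wp_sub_gR htau hv' hu'
  rw [← wp_eq, ← wp_eq, (gth_deriv_zero htau).deriv, ← hzu, ← hzv] at key
  have gu := gth_ne_zero' htau hu'
  have gv := gth_ne_zero' htau hv'
  rw [← hzu] at gu
  rw [← hzv] at gv
  have hd := disc_eq htau
  set q := cexp (2 * Real.pi * I * tau) with hq
  set Q := qE q q with hQ
  have s1 := siegel_eq htau ((u.1 + v.1 : ℚ) : ℝ) ((u.2 + v.2 : ℚ) : ℝ)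
  have s2 := siegel_eq htau ((u.1 - v.1 : ℚ) : ℝ) ((u.2 - v.2 : ℚ) : ℝ)
  have s3 := siegel_eq htau ((u.1 : ℚ) : ℝ) ((u.2 : ℚ) : ℝ)
  have s4 := siegel_eq htau ((v.1 : ℚ) : ℝ) ((v.2 : ℚ) : ℝ)
  have e1 : (((u.1 + v.1 : ℚ) : ℝ) : ℂ) * tau + ((u.2 + v.2 : ℚ) : ℝ) = zu + zv := by
    rw [hzu, hzv]; push_cast; ring
  have e2 : (((u.1 - v.1 : ℚ) : ℝ) : ℂ) * tau + ((u.2 - v.2 : ℚ) : ℝ) = zu - zv := by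
    rw [hzu, hzv]; push_cast; ring
  have e3 : (((u.1 : ℚ) : ℝ) : ℂ) * tau + ((u.2 : ℚ) : ℝ) = zu := by
    rw [hzu]; push_cast; ring
  have e4 : (((v.1 : ℚ) : ℝ) : ℂ) * tau + ((v.2 : ℚ) : ℝ) = zv := by
    rw [hzv]; push_cast; ring
  rw [e1] at s1
  rw [e2] at s2
  rw [e3] at s3
  rw [e4] at s4
  have hX : cexp (2 * Real.pi * I * tau / 12) ^ 12 = q := by
    rw [← Complex.exp_nat_mul, hq]; congr 1; push_cast; ring
  have hE : cexp (Real.pi * I * ((u.1 + v.1 : ℚ) : ℝ) * (zu + zv)) ^ 6 *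
      cexp (Real.pi * I * ((u.1 - v.1 : ℚ) : ℝ) * (zu - zv)) ^ 6 =
      cexp (Real.pi * I * ((u.1 : ℚ) : ℝ) * zu) ^ 12 *
      cexp (Real.pi * I * ((v.1 : ℚ) : ℝ) * zv) ^ 12 := by
    simp only [← Complex.exp_nat_mul, ← Complex.exp_add]
    congr 1
    push_cast
    ring
  have hq0 : q ≠ 0 := Complex.exp_ne_zero _
  have hA := Complex.exp_ne_zero (Real.pi * I * ((u.1 : ℚ) : ℝ) * zu)
  have hB := Complex.exp_ne_zero (Real.pi * I * ((v.1 : ℚ) : ℝ) * zv)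
  -- the ratio of Siegel functions
  have hratio : (siegel (u.1 + v.1 : ℚ) (u.2 + v.2 : ℚ) tau ^ 6 *
          siegel (u.1 - v.1 : ℚ) (u.2 - v.2 : ℚ) tau ^ 6) /
        (siegel (u.1 : ℚ) (u.2 : ℚ) tau ^ 12 * siegel (v.1 : ℚ) (v.2 : ℚ) tau ^ 12) =
      gth tau (zu + zv) ^ 6 * gth tau (zu - zv) ^ 6 / (gth tau zu ^ 12 * gth tau zv ^ 12) / q := by
    rw [s1, s2, s3, s4]
    generalize cexp (Real.pi * I * ((u.1 + v.1 : ℚ) : ℝ) * (zu + zv)) = A1 at *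
    generalize cexp (Real.pi * I * ((u.1 - v.1 : ℚ) : ℝ) * (zu - zv)) = A2 at *
    generalize cexp (Real.pi * I * ((u.1 : ℚ) : ℝ) * zu) = A3 at *
    generalize cexp (Real.pi * I * ((v.1 : ℚ) : ℝ) * zv) = A4 at *
    generalize cexp (2 * Real.pi * I * tau / 12) = X at *
    rw [← hX] at hq0 ⊢
    have hX0 : X ≠ 0 := fun h => hq0 (by rw [h]; norm_num)
    rw [div_div, div_eq_div_iff (by simp [hA, hB, hX0, gu, gv]) (by simp [hX0, gu, gv])]
    linear_combination (gth tau (zu + zv) ^ 6 * gth tau (zu - zv) ^ 6 * gth tau zu ^ 12 *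
      gth tau zv ^ 12 * X ^ 24) * hE
  have hpow : (wp tau 1 zu - wp tau 1 zv) ^ 6 = disc tau 1 *
      ((siegel (u.1 + v.1 : ℚ) (u.2 + v.2 : ℚ) tau ^ 6 *
          siegel (u.1 - v.1 : ℚ) (u.2 - v.2 : ℚ) tau ^ 6) /
        (siegel (u.1 : ℚ) (u.2 : ℚ) tau ^ 12 * siegel (v.1 : ℚ) (v.2 : ℚ) tau ^ 12)) := by
    rw [hratio, key, hd]
    unfold gR
    have hI : (I : ℂ) ^ 12 = 1 := by
      rw [show (12 : ℕ) = 4 * 3 by norm_num, pow_mul, I_pow_four, one_pow]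
    field_simp
    simp only [hI]
    try ring
  have hdisc : disc tau 1 ≠ 0 := by
    have := ModularForm.discriminant_ne_zero ⟨tau, htau⟩
    rw [discriminant_qE, ← hq, ← hQ] at this
    rw [hd, mul_assoc]
    exact mul_ne_zero (by simp [Real.pi_ne_zero]) this
  rw [mul_div_assoc]
  have hf : fricke u.1 u.2 tau - fricke v.1 v.2 tau =
      g2 tau 1 * g3 tau 1 / disc tau 1 * (wp tau 1 zu - wp tau 1 zv) := by
    unfold fricke; rw [← hzu, ← hzv]; ring
  have hj : jInv tau - 1728 = 1728 * 27 * g3 tau 1 ^ 2 / disc tau 1 := by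
    unfold jInv
    rw [div_sub' hdisc]
    congr 1
    unfold disc
    ring
  rw [hf, mul_pow, hpow, hj]
  unfold jInv
  generalize disc tau 1 = D at *
  generalize _ / (siegel _ _ _ ^ 12 * siegel _ _ _ ^ 12) = T
  field_simp
  ring
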